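/- arXiv:2102.08379 — 5 statements merged into one kernel-verified Lean document; each statement's English description precedes it below -/
import Mathlib

section
/- Let n ≥ 3 and let a₁, a₂, …, aₙ be distinct nonzero square-free integers, none equal to 1. Then the polynomial f(x) = (x² − a₁)(x² − a₂)⋯(x² − aₙ) has a root modulo every positive integer if and only if the following two conditions hold: (1) there exists a subset T ⊆ {1, …, n} of odd cardinality such that (a) the product ∏_{j∈T} aⱼ is a perfect square, and (b) for every j ∈ T and every odd prime p dividing aⱼ, there exists i ∈ {1, …, n} with i ≠ j such that the Legendre symbol (aᵢ/p) = +1; and (2) some aᵢ is of the form 8m + 1 for some nonzero integer m. -/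
open scoped NumberTheorySymbols

/-- The Jacobi symbol `J(a | b)` only depends on `b` modulo any multiple of `4 * |a|`. -/
theorem jacobiSym_mod_right_of_dvd {a : ℤ} {N b : ℕ} (h : 4 * a.natAbs ∣ N) (hb : Odd b) :
    J(a | b % N) = J(a | b) := by
  have h2 : 2 ∣ N := (Dvd.intro _ (by ring : 2 * (2 * a.natAbs) = 4 * a.natAbs)).trans h
  have hb' : Odd (b % N) := hb.mod_even (even_iff_two_dvd.mpr h2)
  rw [jacobiSym.mod_right a hb', jacobiSym.mod_right a hb, Nat.mod_mod_of_dvd _ h]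

/-- If the Jacobi symbol of a squarefree integer is trivial at every natural number coprime to
some fixed nonzero multiple of it, then it has no odd prime factor. -/
theorem not_prime_dvd_of_forall_jacobiSym_eq_one {e : ℤ} (he : Squarefree e) {N : ℕ}
    (hN : N ≠ 0) (heN : e ∣ N) (h : ∀ b : ℕ, b.Coprime N → J(e | b) = 1)
    {q : ℕ} (hq : q.Prime) (hq2 : q ≠ 2) : ¬ (q : ℤ) ∣ e := by
  rintro ⟨r, rfl⟩
  have : Fact q.Prime := ⟨hq⟩
  have hqr : ¬ (q : ℤ) ∣ r := by
    rintro ⟨s, rfl⟩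
    exact (Nat.prime_iff_prime_int.mp hq).not_isUnit (he _ ⟨s, by ring⟩)
  obtain ⟨k, M, hM, rfl⟩ := Nat.exists_eq_pow_mul_and_not_dvd hN q hq.ne_one
  have hqrc : r.natAbs.Coprime q := by
    rw [Nat.coprime_comm, hq.coprime_iff_not_dvd]
    exact fun hd => hqr (Int.natCast_dvd.mpr hd)
  have hrM : r.natAbs ∣ M := by
    have : r.natAbs ∣ q ^ k * M := Int.natAbs_dvd_natAbs.mpr ((Dvd.intro_left _ rfl).trans heN)
    exact (hqrc.pow_right k).dvd_of_dvd_mul_left this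
  have hq4 : Nat.Coprime 4 q :=
    Nat.Coprime.pow_left 2 ((Nat.coprime_primes Nat.prime_two hq).mpr hq2.symm)
  have hMq : M.Coprime q := ((hq.coprime_iff_not_dvd).mpr hM).symm
  have hcop : (4 * M).Coprime q := hq4.mul_left hMq
  obtain ⟨c, hc⟩ := FiniteField.exists_nonsquare (F := ZMod q) (by rwa [ZMod.ringChar_zmod_n])
  have hcJ : J((c.val : ℤ) | q) = -1 := by
    refine ZMod.nonsquare_iff_jacobiSym_eq_neg_one.mpr ?_
    simpa using hc
  obtain ⟨b, hb1, hb2⟩ := Nat.chineseRemainder hcop 1 c.val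
  have hbM : b % 4 = 1 := Nat.ModEq.of_mul_right M hb1
  have hbodd : Odd b := Nat.odd_iff.mpr (Nat.odd_of_mod_four_eq_one hbM)
  have hbq : J((b : ℤ) | q) = -1 := by
    rw [← hcJ]
    exact jacobiSym.mod_left' (by exact_mod_cast hb2)
  have hbcop : b.Coprime (q ^ k * M) := by
    refine Nat.Coprime.mul_right (Nat.Coprime.pow_right k ?_) ?_
    · by_contra hne
      have : J((b : ℤ) | q) = 0 :=
        jacobiSym.eq_zero_iff.mpr ⟨hq.ne_zero, by simpa [Int.gcd_natCast_natCast] using hne⟩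
      rw [this] at hbq
      norm_num at hbq
    · have := (Nat.ModEq.of_mul_left 4 hb1).gcd_eq
      rw [Nat.gcd_one_left] at this
      exact this
  have hJq : J((q : ℤ) | b) = -1 := by
    rw [jacobiSym.quadratic_reciprocity_one_mod_four' (hq.odd_of_ne_two hq2) hbM, hbq]
  have hJr : J(r | b) = 1 := by
    have hd : 4 * r.natAbs ∣ 4 * M := Nat.mul_dvd_mul_left 4 hrM
    rw [← jacobiSym_mod_right_of_dvd hd hbodd, show b % (4 * M) = 1 % (4 * M) from hb1,
      jacobiSym_mod_right_of_dvd hd odd_one, jacobiSym.one_right]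
  have := h b hbcop
  rw [jacobiSym.mul_left, hJq, hJr] at this
  norm_num at this

/-- A squarefree integer whose Jacobi symbol is trivial at every natural number coprime to some
fixed even multiple of it equals `1`. -/
theorem eq_one_of_forall_jacobiSym_eq_one {e : ℤ} (he : Squarefree e) {N : ℕ}
    (hN : N ≠ 0) (h2 : 2 ∣ N) (heN : e ∣ N) (h : ∀ b : ℕ, b.Coprime N → J(e | b) = 1) :
    e = 1 := by
  have hpow := Nat.eq_prime_pow_of_unique_prime_dvd (n := e.natAbs) (p := 2)
    (Int.natAbs_ne_zero.mpr he.ne_zero) (fun {q} hq hqe => by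
      by_contra hq2
      exact not_prime_dvd_of_forall_jacobiSym_eq_one he hN heN h hq hq2
        (Int.natCast_dvd.mpr hqe))
  have hsq : Squarefree e.natAbs := Int.squarefree_natAbs.mpr he
  set k := e.natAbs.primeFactorsList.length
  have hk : k ≤ 1 := by
    by_contra! hk
    have : 2 * 2 ∣ e.natAbs := by
      rw [hpow]
      exact pow_dvd_pow 2 hk
    simpa using hsq 2 this
  obtain ⟨j, M, hM, rfl⟩ := Nat.exists_eq_pow_mul_and_not_dvd hN 2 (by norm_num)
  have hM2 : Nat.Coprime 2 M := (Nat.prime_two.coprime_iff_not_dvd).mpr hM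
  have hcop : Nat.Coprime 8 M := Nat.Coprime.pow_left 3 hM2
  have key : ∀ c : ℕ, c % 8 % 2 = 1 → ∃ b : ℕ, b % 8 = c % 8 ∧ Odd b ∧ J(e | b) = 1 := by
    intro c hc
    obtain ⟨b, hb1, hb2⟩ := Nat.chineseRemainder hcop c 1
    have hb1' : b % 8 = c % 8 := hb1
    have hodd : Odd b := Nat.odd_iff.mpr (by omega)
    refine ⟨b, hb1', hodd, h b (Nat.Coprime.mul_right (Nat.Coprime.pow_right _ ?_) ?_)⟩
    · exact hodd.coprime_two_right
    · have := hb2.gcd_eq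
      rwa [Nat.gcd_one_left] at this
  obtain ⟨b, hb8, hbodd, hb⟩ := key 5 (by norm_num)
  obtain ⟨b', hb8', hbodd', hb'⟩ := key 7 (by norm_num)
  have hcases : e = 1 ∨ e = -1 ∨ e = 2 ∨ e = -2 := by
    interval_cases k <;> omega
  rcases hcases with rfl | rfl | rfl | rfl
  · rfl
  · rw [jacobiSym.at_neg_one hbodd', ZMod.χ₄_nat_three_mod_four (by omega)] at hb'
    norm_num at hb'
  · rw [jacobiSym.at_two hbodd, ZMod.χ₈_nat_mod_eight, hb8] at hb
    exact absurd hb (by decide)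
  · rw [jacobiSym.at_neg_two hbodd, ← ZMod.natCast_mod b 8, hb8] at hb
    exact absurd hb (by decide)

/-- A nonzero integer whose Jacobi symbol is trivial at every natural number coprime to some
fixed even multiple of it is a perfect square. -/
theorem isSquare_of_forall_jacobiSym_eq_one {d : ℤ} {N : ℕ}
    (hN : N ≠ 0) (h2 : 2 ∣ N) (hdN : d ∣ N) (h : ∀ b : ℕ, b.Coprime N → J(d | b) = 1) :
    ∃ k : ℤ, d = k ^ 2 := by
  obtain ⟨m, s, hms, hm⟩ := Nat.sq_mul_squarefree d.natAbs
  obtain ⟨e, he, hd⟩ : ∃ e : ℤ, e.natAbs = m ∧ d = s ^ 2 * e := by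
    rcases Int.natAbs_eq d with hd | hd
    · exact ⟨m, by simp, by rw [hd, ← hms]; push_cast; ring⟩
    · exact ⟨-m, by simp, by rw [hd, ← hms]; push_cast; ring⟩
  have hesq : Squarefree e := Int.squarefree_natAbs.mp (he ▸ hm)
  have hsN : (s : ℤ) ∣ N := (Dvd.intro (s * e) (by rw [hd]; ring)).trans hdN
  refine ⟨s, ?_⟩
  have he1 : e = 1 := by
    refine eq_one_of_forall_jacobiSym_eq_one hesq hN h2 ((Dvd.intro_left _ hd.symm).trans hdN) ?_
    intro b hb
    have hJ := h b hb
    have hsb : (s : ℤ).gcd b = 1 := by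
      rw [Int.gcd_natCast_natCast]
      exact (hb.coprime_dvd_right (Int.natCast_dvd_natCast.mp hsN)).symm
    rwa [hd, jacobiSym.mul_left, jacobiSym.sq_one' hsb, one_mul] at hJ
  rw [hd, he1, mul_one]

/-- If every sufficiently large prime admits some `a i` as a quadratic residue, then some product
of an odd number of the `a i` is a perfect square. -/
theorem exists_odd_card_prod_eq_sq {ι : Type*} [Fintype ι] (a : ι → ℤ) (ha : ∀ i, a i ≠ 0)
    (B : ℕ) (h : ∀ p : ℕ, p.Prime → B < p → ∃ i, J(a i | p) = 1) :
    ∃ T : Finset ι, Odd T.card ∧ ∃ k : ℤ, ∏ j ∈ T, a j = k ^ 2 := by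
  classical
  set N : ℕ := 4 * ∏ i, (a i).natAbs with hNdef
  have hN : N ≠ 0 := mul_ne_zero (by norm_num)
    (Finset.prod_ne_zero_iff.mpr fun i _ => Int.natAbs_ne_zero.mpr (ha i))
  have : NeZero N := ⟨hN⟩
  have h2N : 2 ∣ N := Dvd.dvd.mul_right (by norm_num) _
  have haN : ∀ i, 4 * (a i).natAbs ∣ N := fun i =>
    Nat.mul_dvd_mul_left 4 (Finset.dvd_prod_of_mem _ (Finset.mem_univ i))
  have hodd : ∀ b : ℕ, b.Coprime N → Odd b := fun b hb =>
    Nat.coprime_two_right.mp (hb.coprime_dvd_right h2N)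
  have hone : 1 < N := lt_of_lt_of_le (by norm_num) (Nat.le_of_dvd (Nat.pos_of_ne_zero hN) h2N)
  have : Fact (1 < N) := ⟨hone⟩
  let χ : ι → (ZMod N)ˣ →* ℤ := fun i =>
    { toFun := fun u => J(a i | (u : ZMod N).val)
      map_one' := by simp [ZMod.val_one, jacobiSym.one_right]
      map_mul' := fun u v => by
        have hu := ZMod.val_coe_unit_coprime u
        have hv := ZMod.val_coe_unit_coprime v
        have : NeZero (u : ZMod N).val := ⟨(hodd _ hu).pos.ne'⟩
        have : NeZero (v : ZMod N).val := ⟨(hodd _ hv).pos.ne'⟩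
        rw [Units.val_mul, ZMod.val_mul, jacobiSym_mod_right_of_dvd (haN i)
          ((hodd _ hu).mul (hodd _ hv)), jacobiSym.mul_right] }
  have hχ : ∀ i (b : ℕ) (hb : b.Coprime N), χ i (ZMod.unitOfCoprime b hb) = J(a i | b) := by
    intro i b hb
    change J(a i | ((ZMod.unitOfCoprime b hb : (ZMod N)ˣ) : ZMod N).val) = _
    rw [ZMod.coe_unitOfCoprime, ZMod.val_natCast, jacobiSym_mod_right_of_dvd (haN i) (hodd b hb)]
  by_contra! hno
  have hzero : ∀ u : (ZMod N)ˣ, ∏ i, (1 - χ i u) = 0 := by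
    intro u
    obtain ⟨p, hBp, hp, hpu⟩ := Nat.forall_exists_prime_gt_and_eq_mod u.isUnit B
    have hpc : p.Coprime N := (ZMod.isUnit_iff_coprime p N).mp (hpu ▸ u.isUnit)
    have : u = ZMod.unitOfCoprime p hpc := by
      ext
      rw [ZMod.coe_unitOfCoprime, hpu]
    obtain ⟨i, hi⟩ := h p hp hBp
    refine Finset.prod_eq_zero (Finset.mem_univ i) ?_
    rw [this, hχ, hi, sub_self]
  have hsum : ∑ T : Finset ι, (-1) ^ T.card * ∑ u : (ZMod N)ˣ, (∏ i ∈ T, χ i) u = 0 := by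
    rw [← Finset.sum_eq_zero fun u (_ : u ∈ (Finset.univ : Finset (ZMod N)ˣ)) => hzero u]
    simp_rw [sub_eq_add_neg, Finset.prod_one_add, Finset.prod_neg, Finset.powerset_univ,
      Finset.mul_sum, MonoidHom.finsetProd_apply]
    exact Finset.sum_comm
  have hpos : 0 < ∑ T : Finset ι, (-1) ^ T.card * ∑ u : (ZMod N)ˣ, (∏ i ∈ T, χ i) u := by
    refine Finset.sum_pos' (fun T _ => ?_) ⟨∅, Finset.mem_univ _, ?_⟩
    · rw [sum_hom_units]
      rcases Nat.even_or_odd T.card with hT | hT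
      · rw [hT.neg_one_pow]
        split_ifs <;> positivity
      · rw [if_neg, Nat.cast_zero, mul_zero]
        intro hT1
        obtain ⟨k, hk⟩ := isSquare_of_forall_jacobiSym_eq_one (d := ∏ j ∈ T, a j) hN h2N (by
          rw [← Int.natAbs_dvd_natAbs, Int.natAbs_natCast,
            show (∏ j ∈ T, a j).natAbs = ∏ j ∈ T, (a j).natAbs from map_prod Int.natAbsHom a T]
          exact (Finset.prod_dvd_prod_of_subset _ _ _ (Finset.subset_univ T)).trans
            (Dvd.intro_left _ rfl)) (fun b hb => by
          have hJ := DFunLike.congr_fun hT1 (ZMod.unitOfCoprime b hb)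
          simp only [MonoidHom.finsetProd_apply, hχ, MonoidHom.one_apply] at hJ
          rw [← hJ]
          exact map_prod (⟨⟨fun x => J(x | b), jacobiSym.one_left b⟩,
            fun x y => jacobiSym.mul_left x y b⟩ : ℤ →* ℤ) a T)
        exact hno T hT k hk
    · simpa using Nat.pos_of_ne_zero hN
  exact hpos.ne' hsum

/-- If a product of `n` integers is divisible by the `3 * n + 1`-st power of a prime, then some
factor is divisible by the cube of that prime. -/
theorem exists_pow_three_dvd_of_pow_dvd_prod {ι : Type*} [Fintype ι] {p : ℤ} (hp : Prime p)
    (f : ι → ℤ) (h : p ^ (3 * Fintype.card ι + 1) ∣ ∏ i, f i) : ∃ i, p ^ 3 ∣ f i := by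
  by_contra! hno
  have hle : emultiplicity p (∏ i, f i) ≤ (3 * Fintype.card ι : ℕ) := by
    rw [Finset.emultiplicity_prod hp]
    refine (Finset.sum_le_card_nsmul _ _ ((3 : ℕ) : ℕ∞) fun i _ =>
      (emultiplicity_lt_iff_not_dvd.mpr (hno i)).le).trans ?_
    simp [mul_comm]
  have := (le_emultiplicity_of_pow_dvd h).trans hle
  rw [Nat.cast_le] at this
  omega

/-- Hensel lifting of square roots of a quadratic residue modulo an odd prime. -/
theorem exists_pow_dvd_sq_sub_of_odd {p : ℕ} (hp : p.Prime) (hp2 : p ≠ 2) {a : ℤ}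
    (hpa : ¬ (p : ℤ) ∣ a) (h : ∃ x : ℤ, (p : ℤ) ∣ x ^ 2 - a) (k : ℕ) :
    ∃ x : ℤ, (p : ℤ) ^ (k + 1) ∣ x ^ 2 - a := by
  have hpZ : Prime (p : ℤ) := Nat.prime_iff_prime_int.mp hp
  induction k with
  | zero => simpa using h
  | succ k ih =>
    obtain ⟨x, c, hc⟩ := ih
    have hpx : ¬ (p : ℤ) ∣ 2 * x := by
      intro hd
      rcases hpZ.dvd_or_dvd hd with h2 | hx
      · have : p ∣ 2 := by exact_mod_cast h2
        exact hp2 ((Nat.prime_dvd_prime_iff_eq hp Nat.prime_two).mp this)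
      · refine hpa ?_
        have : a = x * x - p * (p ^ k * c) := by linear_combination -hc
        rw [this]
        exact dvd_sub (hx.mul_right x) (Dvd.intro _ rfl)
    obtain ⟨u, v, huv⟩ := (hpZ.coprime_iff_not_dvd).mpr hpx
    refine ⟨x - c * v * p ^ (k + 1), c * u + (c * v) ^ 2 * p ^ k, ?_⟩
    linear_combination hc - c * (p : ℤ) ^ (k + 1) * huv

/-- Integers congruent to `1` modulo `8` are squares modulo every power of `2`. -/
theorem exists_two_pow_dvd_sq_sub {a : ℤ} (h : (8 : ℤ) ∣ a - 1) (k : ℕ) :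
    ∃ x : ℤ, (2 : ℤ) ^ (k + 3) ∣ x ^ 2 - a := by
  induction k with
  | zero => exact ⟨1, by simpa using (dvd_neg.mpr h)⟩
  | succ k ih =>
    obtain ⟨x, c, hc⟩ := ih
    have hx : ∃ y, x = 2 * y + 1 := by
      rcases Int.even_or_odd' x with ⟨y, hy | hy⟩
      · obtain ⟨d, hd⟩ := h
        rw [hy] at hc
        ring_nf at hc
        omega
      · exact ⟨y, hy⟩
    obtain ⟨y, rfl⟩ := hx
    refine ⟨2 * y + 1 - c * 2 ^ (k + 2), -(c * y) + c ^ 2 * 2 ^ k, ?_⟩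
    linear_combination hc

/-- Roots of `∏ i, (x ^ 2 - a i)` modulo all prime powers yield roots modulo all positive
integers. -/
theorem exists_dvd_prod_sq_sub {ι : Type*} [Fintype ι] (a : ι → ℤ)
    (h : ∀ p : ℕ, p.Prime → ∃ i, ∀ k : ℕ, ∃ x : ℤ, (p : ℤ) ^ k ∣ x ^ 2 - a i) (m : ℕ)
    (hm : 0 < m) : ∃ x : ℤ, (m : ℤ) ∣ ∏ i, (x ^ 2 - a i) := by
  induction m using Nat.recOnPosPrimePosCoprime with
  | prime_pow p k hp _ =>
    obtain ⟨i, hi⟩ := h p hp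
    obtain ⟨x, hx⟩ := hi k
    exact ⟨x, by
      push_cast
      exact hx.trans (Finset.dvd_prod_of_mem (fun i => x ^ 2 - a i) (Finset.mem_univ i))⟩
  | zero => omega
  | one => exact ⟨0, by simp⟩
  | coprime r s hr hs hrs ihr ihs =>
    obtain ⟨x, hx⟩ := ihr (by omega)
    obtain ⟨y, hy⟩ := ihs (by omega)
    have hcop : IsCoprime (r : ℤ) s := Nat.isCoprime_iff_coprime.mpr hrs
    obtain ⟨u, v, huv⟩ := id hcop
    have transfer : ∀ {t w z : ℤ}, t ∣ w - z → t ∣ ∏ i, (w ^ 2 - a i) →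
        t ∣ ∏ i, (z ^ 2 - a i) := by
      intro t w z hwz hw
      refine (Int.ModEq.dvd_iff (Int.ModEq.prod fun i _ => ?_)).mp hw
      exact ((Int.modEq_iff_dvd.mpr hwz).symm.pow 2).sub_right _
    refine ⟨x * (v * s) + y * (u * r), ?_⟩
    push_cast
    refine hcop.mul_dvd (transfer ⟨(x - y) * u, ?_⟩ hx) (transfer ⟨(y - x) * v, ?_⟩ hy)
    · linear_combination -x * huv
    · linear_combination -y * huv


/-- **Theorem 1.** Let `n ≥ 3` and let `a 1, …, a n` be distinct nonzero square-free
integers, none equal to `1`. Then `f(x) = ∏ i, (x² - a i)` has a root modulo every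
positive integer iff:
(1) there is a subset `T` of odd cardinality with (a) `∏_{j ∈ T} a j` a perfect square and
(b) for every `j ∈ T` and every odd prime `p ∣ a j` there is `i ≠ j` with Legendre
symbol `(a i / p) = +1`; and
(2) some `a i = 8m + 1` with `m` a nonzero integer. -/
theorem stmt_0 (n : ℕ) (hn : 3 ≤ n) (a : Fin n → ℤ)
    (hinj : Function.Injective a)
    (hne0 : ∀ i, a i ≠ 0) (hsf : ∀ i, Squarefree (a i)) (hne1 : ∀ i, a i ≠ 1) :
    (∀ m : ℕ, 0 < m → ∃ x : ℤ, (m : ℤ) ∣ ∏ i, (x ^ 2 - a i)) ↔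
      ((∃ T : Finset (Fin n), Odd T.card ∧
          (∃ k : ℤ, ∏ j ∈ T, a j = k ^ 2) ∧
          (∀ j ∈ T, ∀ p : ℕ, ∀ hp : p.Prime, p ≠ 2 → (p : ℤ) ∣ a j →
            ∃ i : Fin n, i ≠ j ∧ @legendreSym p ⟨hp⟩ (a i) = 1)) ∧
        (∃ i : Fin n, ∃ m : ℤ, m ≠ 0 ∧ a i = 8 * m + 1)) := by
  constructor
  · intro h
    have hloc : ∀ p : ℕ, p.Prime → ∃ i, ∃ x : ℤ, (p : ℤ) ^ 3 ∣ x ^ 2 - a i ∧ ¬ (p : ℤ) ∣ x := by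
      intro p hp
      have hpZ := Nat.prime_iff_prime_int.mp hp
      obtain ⟨x, hx⟩ := h (p ^ (3 * Fintype.card (Fin n) + 1)) (pow_pos hp.pos _)
      push_cast at hx
      obtain ⟨i, hi⟩ := exists_pow_three_dvd_of_pow_dvd_prod hpZ (fun i => x ^ 2 - a i) hx
      refine ⟨i, x, hi, ?_⟩
      rintro ⟨y, rfl⟩
      obtain ⟨c, hc⟩ := hi
      exact hpZ.not_isUnit (hsf i p ⟨y ^ 2 - p * c, by linear_combination -hc⟩)
    have hodd : ∀ p : ℕ, ∀ hp : p.Prime, ∃ i, @legendreSym p ⟨hp⟩ (a i) = 1 := by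
      intro p hp
      have : Fact p.Prime := ⟨hp⟩
      obtain ⟨i, x, hx, hpx⟩ := hloc p hp
      have hdvd : (p : ℤ) ∣ x ^ 2 - a i := (dvd_pow_self _ (by norm_num)).trans hx
      have heq : ((a i : ℤ) : ZMod p) = (x : ZMod p) ^ 2 := by
        have := (ZMod.intCast_zmod_eq_zero_iff_dvd _ p).mpr hdvd
        push_cast at this
        exact (sub_eq_zero.mp this).symm
      have hx0 : (x : ZMod p) ≠ 0 := by
        rwa [Ne, ZMod.intCast_zmod_eq_zero_iff_dvd]
      refine ⟨i, (legendreSym.eq_one_iff p ?_).mpr ⟨x, by rw [heq, sq]⟩⟩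
      rw [heq]
      exact pow_ne_zero 2 hx0
    refine ⟨?_, ?_⟩
    · obtain ⟨T, hT, hk⟩ := exists_odd_card_prod_eq_sq a hne0 0 fun p hp _ => by
        have : Fact p.Prime := ⟨hp⟩
        obtain ⟨i, hi⟩ := hodd p hp
        exact ⟨i, by rw [← jacobiSym.legendreSym.to_jacobiSym, hi]⟩
      refine ⟨T, hT, hk, fun j _ p hp _ hpj => ?_⟩
      obtain ⟨i, hi⟩ := hodd p hp
      refine ⟨i, ?_, hi⟩
      rintro rfl
      have : Fact p.Prime := ⟨hp⟩
      rw [(legendreSym.eq_zero_iff p _).mpr ((ZMod.intCast_zmod_eq_zero_iff_dvd _ p).mpr hpj)] at hi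
      norm_num at hi
    · obtain ⟨i, x, ⟨c, hc⟩, hx⟩ := hloc 2 Nat.prime_two
      have hx8 : 8 ∣ x ^ 2 - 1 := Int.eight_dvd_sq_sub_one_of_odd
        (Int.not_even_iff_odd.mp fun he => hx (by exact_mod_cast he.two_dvd))
      norm_num at hc
      refine ⟨i, (a i - 1) / 8, fun h0 => ?_, by omega⟩
      have := hne1 i
      omega
  · rintro ⟨⟨T, hT, ⟨k, hk⟩, hdiv⟩, i₀, m, _, hi₀⟩
    refine exists_dvd_prod_sq_sub a fun p hp => ?_
    rcases eq_or_ne p 2 with rfl | hp2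
    · refine ⟨i₀, fun k => ?_⟩
      obtain ⟨x, hx⟩ := exists_two_pow_dvd_sq_sub (a := a i₀) ⟨m, by rw [hi₀]; ring⟩ k
      exact ⟨x, (pow_dvd_pow _ (Nat.le_add_right k 3)).trans (by exact_mod_cast hx)⟩
    have : Fact p.Prime := ⟨hp⟩
    obtain ⟨i, hi⟩ : ∃ i, legendreSym p (a i) = 1 := by
      by_cases hpT : ∃ j ∈ T, (p : ℤ) ∣ a j
      · obtain ⟨j, hj, hpj⟩ := hpT
        obtain ⟨i, _, hi⟩ := hdiv j hj p hp hp2 hpj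
        exact ⟨i, hi⟩
      push Not at hpT
      have hne : ∀ j ∈ T, ((a j : ℤ) : ZMod p) ≠ 0 := fun j hj => by
        rw [Ne, ZMod.intCast_zmod_eq_zero_iff_dvd]
        exact hpT j hj
      by_contra! hno
      have hprod : legendreSym p (∏ j ∈ T, a j) = -1 := by
        have hmap : legendreSym p (∏ j ∈ T, a j) = ∏ j ∈ T, legendreSym p (a j) :=
          map_prod (legendreSym.hom p) a T
        rw [hmap, Finset.prod_congr rfl fun j hj =>
          (legendreSym.eq_one_or_neg_one p (hne j hj)).resolve_left (hno j),
          Finset.prod_const, hT.neg_one_pow]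
      rw [legendreSym.eq_neg_one_iff, hk] at hprod
      exact hprod ⟨k, by push_cast; ring⟩
    have hpa : ((a i : ℤ) : ZMod p) ≠ 0 := fun h0 => by
      rw [(legendreSym.eq_zero_iff p _).mpr h0] at hi
      norm_num at hi
    obtain ⟨y, hy⟩ := (legendreSym.eq_one_iff p hpa).mp hi
    refine ⟨i, fun k => ?_⟩
    obtain ⟨x, hx⟩ := exists_pow_dvd_sq_sub_of_odd hp hp2 (a := a i)
      (fun hd => hpa ((ZMod.intCast_zmod_eq_zero_iff_dvd _ p).mpr hd))
      ⟨y.val, by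
        rw [← ZMod.intCast_zmod_eq_zero_iff_dvd]
        push_cast
        rw [ZMod.natCast_zmod_val, hy]
        ring⟩ k
    exact ⟨x, (pow_dvd_pow _ (Nat.le_succ k)).trans hx⟩
end

section
/- Let n ≥ 3 and let a₁, a₂, …, aₙ be distinct nonzero square-free integers, none equal to 1. If the polynomial f(x) = (x² − a₁)(x² − a₂)⋯(x² − aₙ) has a root modulo every positive integer, then (1) there exists a subset T ⊆ {1, …, n} of odd cardinality such that (a) the product ∏_{j∈T} aⱼ is a perfect square, and (b) for every j ∈ T and every odd prime p dividing aⱼ, there exists i ∈ {1, …, n} with i ≠ j such that the Legendre symbol (aᵢ/p) = +1; and (2) some aᵢ equals 8m + 1 for some nonzero integer m. -/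
open scoped NumberTheorySymbols

lemma jacobiSym_congr_right {a : ℤ} {N b c : ℕ} (hN : 4 * a.natAbs ∣ N) (hb : Odd b) (hc : Odd c)
    (h : b ≡ c [MOD N]) : J(a | b) = J(a | c) := by
  rw [jacobiSym.mod_right a hb, jacobiSym.mod_right a hc, (h.of_dvd hN : _ % _ = _ % _)]

lemma Nat.Coprime.odd_of_four_dvd {b N : ℕ} (hb : b.Coprime N) (h4 : 4 ∣ N) : Odd b := by
  have h : b.Coprime 2 := hb.coprime_dvd_right (dvd_trans (by norm_num) h4)
  exact Nat.coprime_two_right.1 h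

lemma exists_jacobiSym_eq_neg_one_of_odd_prime_dvd {D : ℤ} (hD : Squarefree D) {q : ℕ}
    (hq : q.Prime) (hq2 : q ≠ 2) (hqD : (q : ℤ) ∣ D) {N : ℕ} (hN0 : N ≠ 0)
    (hN : 4 * D.natAbs ∣ N) : ∃ b : ℕ, b.Coprime N ∧ J(D | b) = -1 := by
  have : Fact q.Prime := ⟨hq⟩
  obtain ⟨r, rfl⟩ := hqD
  have hqr : ¬ q ∣ r.natAbs := by
    intro h
    have h' : (q : ℤ) ∣ r := Int.natCast_dvd.2 h
    have := hD q (mul_dvd_mul_left _ h')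
    rw [Int.isUnit_iff_natAbs_eq, Int.natAbs_natCast] at this
    exact hq.one_lt.ne' this
  obtain ⟨k, M, hqM, rfl⟩ := Nat.exists_eq_pow_mul_and_not_dvd hN0 q hq.ne_one
  have hcop : ∀ x : ℕ, ¬ q ∣ x → x.Coprime q := fun x hx =>
    ((Nat.Prime.coprime_iff_not_dvd hq).2 hx).symm
  have hq4 : ¬ q ∣ 4 * r.natAbs := by
    intro h
    rcases (Nat.Prime.dvd_mul hq).1 h with h | h
    · have : q ∣ 2 ^ 2 := by simpa using h
      exact hq2 ((Nat.prime_dvd_prime_iff_eq hq Nat.prime_two).1 (hq.dvd_of_dvd_pow this))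
    · exact hqr h
  have hrM : 4 * r.natAbs ∣ M := by
    have h1 : 4 * r.natAbs ∣ q ^ k * M := by
      refine dvd_trans ?_ hN
      rw [Int.natAbs_mul]
      exact mul_dvd_mul_left _ (dvd_mul_left _ _)
    exact Nat.Coprime.dvd_of_dvd_mul_left ((hcop _ hq4).pow_right k) h1
  have h4M : 4 ∣ M := dvd_trans (dvd_mul_right _ _) hrM
  obtain ⟨c, hc⟩ := FiniteField.exists_nonsquare (F := ZMod q) (by rwa [ZMod.ringChar_zmod_n])
  have hc0 : c ≠ 0 := by rintro rfl; exact hc IsSquare.zero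
  obtain ⟨b, hbM, hbq⟩ := Nat.chineseRemainder (hcop M hqM) 1 c.val
  have hbc : (b : ZMod q) = c := by
    rw [(ZMod.natCast_eq_natCast_iff _ _ _).2 hbq, ZMod.natCast_zmod_val]
  have hbM' : b.Coprime M := by
    have := hbM.gcd_eq
    simpa [Nat.coprime_iff_gcd_eq_one] using this
  have hbq' : b.Coprime q := by
    apply hcop
    rw [← ZMod.natCast_eq_zero_iff, hbc]
    exact hc0
  have hb_odd : Odd b := hbM'.odd_of_four_dvd h4M
  refine ⟨b, (hbq'.pow_right k).mul_right hbM', ?_⟩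
  rw [jacobiSym.mul_left, jacobiSym_congr_right hrM hb_odd odd_one hbM, jacobiSym.one_right,
    mul_one, jacobiSym.quadratic_reciprocity_one_mod_four' (hq.odd_of_ne_two hq2)
      (hbM.of_dvd h4M), ← jacobiSym.legendreSym.to_jacobiSym, legendreSym.eq_neg_one_iff']
  rwa [hbc]

lemma Nat.eq_one_or_two_of_squarefree {d : ℕ} (hd : Squarefree d)
    (h : ∀ q : ℕ, q.Prime → q ∣ d → q = 2) : d = 1 ∨ d = 2 := by
  by_cases h1 : d = 1
  · exact Or.inl h1
  obtain ⟨p, hp, hpd⟩ := Nat.exists_prime_and_dvd h1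
  obtain rfl := h p hp hpd
  obtain ⟨m, rfl⟩ := hpd
  by_cases hm : m = 1
  · exact Or.inr (by rw [hm])
  obtain ⟨p, hp', hpm⟩ := Nat.exists_prime_and_dvd hm
  obtain rfl := h p hp' (hpm.mul_left _)
  have := hd 2 (mul_dvd_mul_left _ hpm)
  simp at this

lemma exists_jacobiSym_eq_neg_one_of_squarefree {D : ℤ} (hD : Squarefree D) (hD1 : D ≠ 1) {N : ℕ}
    (hN0 : N ≠ 0) (hN : 4 * D.natAbs ∣ N) : ∃ b : ℕ, b.Coprime N ∧ J(D | b) = -1 := by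
  by_cases h : ∃ q : ℕ, q.Prime ∧ q ≠ 2 ∧ (q : ℤ) ∣ D
  · obtain ⟨q, hq, hq2, hqD⟩ := h
    exact exists_jacobiSym_eq_neg_one_of_odd_prime_dvd hD hq hq2 hqD hN0 hN
  push Not at h
  have h4 : 4 ∣ N := dvd_trans (dvd_mul_right _ _) hN
  have hD' := Nat.eq_one_or_two_of_squarefree (Int.squarefree_natAbs.2 hD) fun q hq hqD => by
    by_contra h2
    exact h q hq h2 (Int.natCast_dvd.2 hqD)
  rcases hD' with hD' | hD'
  · obtain rfl : D = -1 := by omega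
    have hcop : (N - 1).Coprime N :=
      (Nat.coprime_self_sub_left (Nat.one_le_iff_ne_zero.2 hN0)).2 (Nat.coprime_one_left N)
    refine ⟨N - 1, hcop, ?_⟩
    rw [jacobiSym.at_neg_one (hcop.odd_of_four_dvd h4)]
    exact ZMod.χ₄_nat_three_mod_four (by omega)
  · obtain ⟨k, M, h2M, rfl⟩ := Nat.exists_eq_pow_mul_and_not_dvd hN0 2 (by norm_num)
    have hM2 : M.Coprime 2 := ((Nat.Prime.coprime_iff_not_dvd Nat.prime_two).2 h2M).symm
    have hM8 : M.Coprime 8 := hM2.pow_right 3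
    obtain ⟨b, hbM, hb8⟩ := Nat.chineseRemainder hM8 1 5
    have hb8 : b % 8 = 5 := hb8
    have hb_odd : Odd b := Nat.odd_iff.2 (by omega)
    have hbM' : b.Coprime M := by
      have := hbM.gcd_eq
      simpa [Nat.coprime_iff_gcd_eq_one] using this
    refine ⟨b, ((Nat.coprime_two_right.2 hb_odd).pow_right k).mul_right hbM', ?_⟩
    rcases Int.natAbs_eq D with h | h <;> rw [h, hD']
    · rw [Nat.cast_ofNat, jacobiSym.at_two hb_odd, ZMod.χ₈_nat_eq_if_mod_eight]
      simp [hb8]; omega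
    · rw [Nat.cast_ofNat, jacobiSym.at_neg_two hb_odd, ZMod.χ₈'_nat_eq_if_mod_eight]
      simp [hb8]; omega

lemma exists_jacobiSym_eq_neg_one {A : ℤ} (hA : ¬ IsSquare A) {N : ℕ}
    (hN0 : N ≠ 0) (hN : 4 * A.natAbs ∣ N) : ∃ b : ℕ, b.Coprime N ∧ J(A | b) = -1 := by
  obtain ⟨s, t, hst, hs⟩ := Nat.sq_mul_squarefree A.natAbs
  obtain ⟨D, hDs, hAD⟩ : ∃ D : ℤ, D.natAbs = s ∧ A = t ^ 2 * D := by
    rcases Int.natAbs_eq A with h | h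
    · exact ⟨s, by simp, by rw [h, ← hst]; push_cast; ring⟩
    · exact ⟨-s, by simp, by rw [h, ← hst]; push_cast; ring⟩
  have hD1 : D ≠ 1 := by
    rintro rfl
    exact hA ⟨t, by rw [hAD]; ring⟩
  subst hDs
  obtain ⟨b, hb, hJ⟩ := exists_jacobiSym_eq_neg_one_of_squarefree (Int.squarefree_natAbs.1 hs) hD1
    hN0 (dvd_trans (mul_dvd_mul_left _ ⟨t ^ 2, by rw [← hst, mul_comm]⟩) hN)
  refine ⟨b, hb, ?_⟩
  have htN : t ∣ N := by
    refine dvd_trans ?_ hN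
    rw [← hst]
    exact Dvd.intro (4 * t * D.natAbs) (by ring)
  have htb : Int.gcd (t : ℤ) b = 1 := by
    rw [Int.gcd_natCast_natCast]
    exact (hb.coprime_dvd_right htN).symm
  rw [hAD, jacobiSym.mul_left, jacobiSym.sq_one' htb, one_mul, hJ]

lemma ZMod.odd_val_coe_unit {N : ℕ} (h4 : 4 ∣ N) (u : (ZMod N)ˣ) : Odd (u : ZMod N).val :=
  (ZMod.val_coe_unit_coprime u).odd_of_four_dvd h4

lemma sum_jacobiSym_units_eq_zero {A : ℤ} (hA : ¬ IsSquare A) {N : ℕ} [NeZero N]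
    (hN : 4 * A.natAbs ∣ N) : ∑ u : (ZMod N)ˣ, J(A | (u : ZMod N).val) = 0 := by
  have h4 : 4 ∣ N := dvd_trans (dvd_mul_right _ _) hN
  obtain ⟨b, hb, hJ⟩ := exists_jacobiSym_eq_neg_one hA (NeZero.ne N) hN
  have hb_odd := hb.odd_of_four_dvd h4
  have key : ∀ u : (ZMod N)ˣ, J(A | ((ZMod.unitOfCoprime b hb * u : (ZMod N)ˣ) : ZMod N).val)
      = -J(A | (u : ZMod N).val) := by
    intro u
    have hu := ZMod.odd_val_coe_unit h4 u
    rw [jacobiSym_congr_right hN (ZMod.odd_val_coe_unit h4 _) (hb_odd.mul hu),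
      jacobiSym.mul_right' A hb_odd.pos.ne' hu.pos.ne', hJ, neg_one_mul]
    rw [← ZMod.natCast_eq_natCast_iff]
    simp
  have h := Fintype.sum_equiv (Equiv.mulLeft (ZMod.unitOfCoprime b hb))
    (fun u : (ZMod N)ˣ => -J(A | (u : ZMod N).val)) (fun u => J(A | (u : ZMod N).val))
    (fun u => (key u).symm)
  rw [Finset.sum_neg_distrib] at h
  linarith

lemma jacobiSym_prod_left {ι : Type*} (s : Finset ι) (a : ι → ℤ) (b : ℕ) :
    J(∏ i ∈ s, a i | b) = ∏ i ∈ s, J(a i | b) := by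
  classical
  induction s using Finset.induction_on with
  | empty => simp [jacobiSym.one_left]
  | insert i s hi ih => rw [Finset.prod_insert hi, Finset.prod_insert hi, jacobiSym.mul_left, ih]

/-- If at every unit modulo `N` some `a i` has Jacobi symbol `1`, then an odd number
of the `a i` multiply to a square. -/
lemma exists_odd_card_isSquare_prod {ι : Type*} [Fintype ι] {a : ι → ℤ} {N : ℕ} [NeZero N]
    (hN : 4 * (∏ i, a i).natAbs ∣ N)
    (h : ∀ u : (ZMod N)ˣ, ∃ i, J(a i | (u : ZMod N).val) = 1) :
    ∃ T : Finset ι, Odd T.card ∧ IsSquare (∏ i ∈ T, a i) := by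
  classical
  by_contra! hT
  have h0 : ∑ u : (ZMod N)ˣ, ∏ i, (1 + -J(a i | (u : ZMod N).val)) = 0 := by
    refine Finset.sum_eq_zero fun u _ => ?_
    obtain ⟨i, hi⟩ := h u
    exact Finset.prod_eq_zero (Finset.mem_univ i) (by rw [hi]; norm_num)
  simp_rw [Finset.prod_one_add] at h0
  rw [Finset.sum_comm] at h0
  have hpos : 0 < ∑ T ∈ (Finset.univ : Finset ι).powerset,
      ∑ u : (ZMod N)ˣ, ∏ i ∈ T, -J(a i | (u : ZMod N).val) := by
    refine Finset.sum_pos' (fun T _ => ?_) ⟨∅, by simp, by simp [NeZero.pos N]⟩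
    simp_rw [Finset.prod_neg, ← jacobiSym_prod_left]
    by_cases hsq : IsSquare (∏ i ∈ T, a i)
    · have hev : Even T.card := Nat.not_odd_iff_even.1 fun ho => hT T ho hsq
      obtain ⟨k, hk⟩ := hsq
      simp_rw [hk, hev.neg_one_pow, one_mul, jacobiSym.mul_left]
      exact Finset.sum_nonneg fun u _ => mul_self_nonneg _
    · rw [← Finset.mul_sum, sum_jacobiSym_units_eq_zero hsq, mul_zero]
      refine dvd_trans (mul_dvd_mul_left _ ?_) hN
      exact Int.natAbs_dvd_natAbs.2 (Finset.prod_dvd_prod_of_subset _ _ _ (Finset.subset_univ T))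
  exact hpos.ne' h0

/-- If a large power of a prime divides a product, a prescribed power divides some factor. -/
lemma Prime.exists_pow_dvd_of_pow_dvd_prod {ι : Type*} {p : ℤ} (hp : Prime p) (k : ℕ)
    (s : Finset ι) (g : ι → ℤ) (h : p ^ (k * s.card + 1) ∣ ∏ i ∈ s, g i) :
    ∃ i ∈ s, p ^ (k + 1) ∣ g i := by
  by_contra! hg
  rw [pow_dvd_iff_le_emultiplicity, Finset.emultiplicity_prod hp] at h
  have hle : ∑ i ∈ s, emultiplicity p (g i) ≤ ∑ _i ∈ s, (k : ℕ∞) := by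
    refine Finset.sum_le_sum fun i hi => ?_
    have := hg i hi
    rw [pow_dvd_iff_le_emultiplicity, not_le] at this
    push_cast at this
    exact Order.le_of_lt_add_one this
  have h' := h.trans hle
  rw [Finset.sum_const, nsmul_eq_mul] at h'
  have h'' : k * s.card + 1 ≤ s.card * k := by exact_mod_cast h'
  rw [mul_comm] at h''
  omega

lemma Int.not_dvd_of_sq_dvd_sq_sub {p x a : ℤ} (hp : Prime p) (ha : Squarefree a)
    (h : p ^ 2 ∣ x ^ 2 - a) : ¬ p ∣ a := by
  intro hpa
  have hx : p ∣ x := hp.dvd_of_dvd_pow (n := 2) <| by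
    simpa using dvd_add ((dvd_pow_self p two_ne_zero).trans h) hpa
  have h2 : p * p ∣ a := by
    rw [← sq]
    simpa using dvd_sub (pow_dvd_pow_of_dvd hx 2) h
  exact hp.not_isUnit (ha p h2)

lemma legendreSym_eq_one_of_dvd_sq_sub {p : ℕ} [Fact p.Prime] {x a : ℤ} (h : (p : ℤ) ∣ x ^ 2 - a)
    (ha : ¬ (p : ℤ) ∣ a) : legendreSym p a = 1 := by
  rw [legendreSym.eq_one_iff p (by rwa [Ne, ZMod.intCast_zmod_eq_zero_iff_dvd])]
  refine ⟨x, ?_⟩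
  have := (ZMod.intCast_zmod_eq_zero_iff_dvd _ p).2 h
  push_cast at this
  rw [← sq]
  exact (sub_eq_zero.1 this).symm

theorem stmt_2 (n : ℕ) (hn : 3 ≤ n) (a : Fin n → ℤ)
    (hinj : Function.Injective a)
    (hne0 : ∀ i, a i ≠ 0) (hsf : ∀ i, Squarefree (a i)) (hne1 : ∀ i, a i ≠ 1)
    (hroots : ∀ m : ℕ, 0 < m → ∃ x : ℤ, (m : ℤ) ∣ ∏ i, (x ^ 2 - a i)) :
    (∃ T : Finset (Fin n), Odd T.card ∧
        (∃ k : ℤ, ∏ j ∈ T, a j = k ^ 2) ∧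
        (∀ j ∈ T, ∀ p : ℕ, ∀ hp : p.Prime, p ≠ 2 → (p : ℤ) ∣ a j →
          ∃ i : Fin n, i ≠ j ∧ @legendreSym p ⟨hp⟩ (a i) = 1)) ∧
      (∃ i : Fin n, ∃ m : ℤ, m ≠ 0 ∧ a i = 8 * m + 1) := by
  have hlocal : ∀ q : ℕ, q.Prime → ∀ k : ℕ, ∃ x : ℤ, ∃ i, (q : ℤ) ^ (k + 1) ∣ x ^ 2 - a i := by
    intro q hq k
    obtain ⟨x, hx⟩ := hroots (q ^ (k * n + 1)) (pow_pos hq.pos _)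
    obtain ⟨i, -, hi⟩ := (Nat.prime_iff_prime_int.1 hq).exists_pow_dvd_of_pow_dvd_prod k
      Finset.univ (fun i => x ^ 2 - a i) (by simpa using hx)
    exact ⟨x, i, hi⟩
  refine ⟨?_, ?_⟩
  · have hP : ∏ i, a i ≠ 0 := Finset.prod_ne_zero_iff.2 fun i _ => hne0 i
    set N := 4 * (∏ i, a i).natAbs with hN
    have : NeZero N := ⟨by positivity⟩
    have h4 : 4 ∣ N := dvd_mul_right _ _
    obtain ⟨T, hT, k, hk⟩ := exists_odd_card_isSquare_prod (a := a) (N := N) dvd_rfl fun u => by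
      obtain ⟨p, -, hp, hpu⟩ := Nat.forall_exists_prime_gt_and_eq_mod u.isUnit 0
      have : Fact p.Prime := ⟨hp⟩
      have hpN : p.Coprime N := (ZMod.isUnit_iff_coprime p N).1 (hpu ▸ u.isUnit)
      obtain ⟨x, i, hx⟩ := hlocal p hp 0
      rw [zero_add, pow_one] at hx
      have haN : 4 * (a i).natAbs ∣ N :=
        mul_dvd_mul_left _ (Int.natAbs_dvd_natAbs.2 (Finset.dvd_prod_of_mem a (Finset.mem_univ i)))
      have hpa : ¬ (p : ℤ) ∣ a i := fun h =>
        (Nat.Prime.coprime_iff_not_dvd hp).1 hpN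
          (((Int.natCast_dvd.1 h).mul_left 4).trans haN)
      refine ⟨i, ?_⟩
      rw [jacobiSym_congr_right haN (ZMod.odd_val_coe_unit h4 u) (hpN.odd_of_four_dvd h4)
        (c := p), ← jacobiSym.legendreSym.to_jacobiSym]
      · exact legendreSym_eq_one_of_dvd_sq_sub hx hpa
      · rw [← ZMod.natCast_eq_natCast_iff, ZMod.natCast_zmod_val, hpu]
    refine ⟨T, hT, ⟨k, by rw [hk, sq]⟩, fun j _ p hp _ hpj => ?_⟩
    obtain ⟨x, i, hx⟩ := hlocal p hp 1
    have hpi := Int.not_dvd_of_sq_dvd_sq_sub (Nat.prime_iff_prime_int.1 hp) (hsf i) hx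
    refine ⟨i, by rintro rfl; exact hpi hpj, ?_⟩
    have : Fact p.Prime := ⟨hp⟩
    exact legendreSym_eq_one_of_dvd_sq_sub ((dvd_pow_self _ two_ne_zero).trans hx) hpi
  · obtain ⟨x, i, hx⟩ := hlocal 2 Nat.prime_two 2
    have h2 : ¬ (2 : ℤ) ∣ a i := Int.not_dvd_of_sq_dvd_sq_sub Int.prime_two (hsf i)
      ((pow_dvd_pow 2 (by norm_num)).trans hx)
    have hx8 : (8 : ℤ) ∣ x ^ 2 - a i := by simpa using hx
    have hx_odd : Odd x := by
      rw [← Int.not_even_iff_odd]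
      intro he
      have : Even (x ^ 2) := he.pow_of_ne_zero two_ne_zero
      obtain ⟨c, hc⟩ := this
      omega
    have hsq := Int.eight_dvd_sq_sub_one_of_odd hx_odd
    have := hne1 i
    exact ⟨i, a i / 8, by omega, by omega⟩
end

section
/- Let p be a prime, let k, n be positive integers, and let a₁, …, aₙ be integers. If for every i ∈ {1, …, n} the congruence x² ≡ aᵢ (mod p^k) has no integer solution, then the congruence (x² − a₁)(x² − a₂)⋯(x² − aₙ) ≡ 0 (mod p^{kn}) has no integer solution. -/
/-- If a prime power `p ^ k` divides no factor of a nonempty product of `n` factors, then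
`p ^ (k * n)` does not divide the product. -/
theorem Prime.not_pow_mul_card_dvd_prod {M ι : Type*} [CommMonoidWithZero M]
    [IsCancelMulZero M] {p : M} (hp : Prime p) {k : ℕ} {s : Finset ι} (hs : s.Nonempty)
    {f : ι → M} (h : ∀ i ∈ s, ¬ p ^ k ∣ f i) : ¬ p ^ (k * s.card) ∣ ∏ i ∈ s, f i := by
  obtain ⟨j, hj⟩ := hs
  obtain ⟨m, rfl⟩ : ∃ m, k = m + 1 := Nat.exists_eq_succ_of_ne_zero <| by
    rintro rfl
    exact h j hj (by simp)
  rw [← emultiplicity_lt_iff_not_dvd, Finset.emultiplicity_prod hp]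
  calc ∑ i ∈ s, emultiplicity p (f i) ≤ s.card • (m : ℕ∞) :=
        Finset.sum_le_card_nsmul _ _ _ fun i hi ↦ by
          have hlt := emultiplicity_lt_iff_not_dvd.2 (h i hi)
          push_cast at hlt
          exact Order.le_of_lt_add_one hlt
    _ < (((m + 1) * s.card : ℕ) : ℕ∞) := by
        have hcard := Finset.card_pos.2 ⟨j, hj⟩
        rw [nsmul_eq_mul]
        exact_mod_cast (by nlinarith : s.card * m < (m + 1) * s.card)

/-- **Lemma 3.** Let `p` be prime, `k, n ≥ 1`, and `a 1, …, a n` integers. If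
`x² ≡ a i (mod p^k)` is unsolvable for every `i`, then
`∏ i, (x² - a i) ≡ 0 (mod p^(k*n))` is unsolvable. -/
theorem stmt_6 (p : ℕ) (hp : p.Prime) (k n : ℕ) (hk : 1 ≤ k) (hn : 1 ≤ n)
    (a : Fin n → ℤ)
    (h : ∀ i : Fin n, ¬ ∃ x : ℤ, (p : ℤ) ^ k ∣ x ^ 2 - a i) :
    ¬ ∃ x : ℤ, (p : ℤ) ^ (k * n) ∣ ∏ i, (x ^ 2 - a i) := by
  rintro ⟨x, hx⟩
  refine (Nat.prime_iff_prime_int.1 hp).not_pow_mul_card_dvd_prod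
    (s := Finset.univ) ⟨⟨0, hn⟩, Finset.mem_univ _⟩ (fun i _ hi ↦ h i ⟨x, hi⟩) ?_
  rwa [Finset.card_fin]
end

section
/- Let n ≥ 1 and let a₁, a₂, …, aₙ be square-free integers. Suppose there is an index j and an odd prime p dividing aⱼ such that for every i ≠ j the Legendre symbol (aᵢ/p) ≠ +1. Then the congruence (x² − a₁)(x² − a₂)⋯(x² − aₙ) ≡ 0 (mod p^{2n}) has no integer solution. -/
/-- If no factor of a product is divisible by `p ^ 2`, for `p` prime, then the product is
not divisible by a power of `p` exceeding the number of factors. -/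
theorem Prime.not_pow_dvd_prod_of_not_sq_dvd {ι R : Type*} [CommRing R] [IsDomain R]
    {p : R} (hp : Prime p) (s : Finset ι) (f : ι → R) (hf : ∀ i ∈ s, ¬ p ^ 2 ∣ f i)
    {k : ℕ} (hk : s.card < k) : ¬ p ^ k ∣ ∏ i ∈ s, f i := by
  rw [← emultiplicity_lt_iff_not_dvd, Finset.emultiplicity_prod hp]
  have hle : ∀ i ∈ s, emultiplicity p (f i) ≤ 1 := fun i hi =>
    Order.le_of_lt_add_one (emultiplicity_lt_iff_not_dvd.mpr (hf i hi))
  calc ∑ i ∈ s, emultiplicity p (f i) ≤ ∑ _i ∈ s, (1 : ℕ∞) := Finset.sum_le_sum hle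
    _ = (s.card : ℕ∞) := by simp
    _ < k := by exact_mod_cast hk

/-- If `p` divides a squarefree `a`, then `p ^ 2` does not divide `x ^ 2 - a`. -/
theorem Prime.not_sq_dvd_sq_sub_of_squarefree {R : Type*} [CommRing R] {p a : R} (hp : Prime p)
    (ha : Squarefree a) (hpa : p ∣ a) (x : R) : ¬ p ^ 2 ∣ x ^ 2 - a := by
  intro hd
  have hx : p ∣ x := hp.dvd_of_dvd_pow
    ((dvd_sub_left hpa).mp ((dvd_pow_self p two_ne_zero).trans hd))
  have hsq : p ^ 2 ∣ a := (dvd_sub_right (pow_dvd_pow_of_dvd hx 2)).mp hd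
  exact hp.not_isUnit (ha p (by rwa [← sq]))

/-- If `a` is prime to `p` and not a square modulo `p`, then `p` does not divide `x ^ 2 - a`. -/
theorem legendreSym.not_dvd_sq_sub {p : ℕ} [Fact p.Prime] {a : ℤ} (hpa : ¬ (p : ℤ) ∣ a)
    (ha : legendreSym p a ≠ 1) (x : ℤ) : ¬ (p : ℤ) ∣ x ^ 2 - a := by
  intro hd
  refine ha ((legendreSym.eq_one_iff p ?_).mpr ⟨x, ?_⟩)
  · rwa [Ne, ZMod.intCast_zmod_eq_zero_iff_dvd]
  · have h0 := (ZMod.intCast_zmod_eq_zero_iff_dvd _ p).mpr hd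
    push_cast at h0
    linear_combination -h0


/-- Let `n ≥ 1` and `a 1, …, a n` be square-free integers. If there is an index `j`
and an odd prime `p ∣ a j` such that `(a i / p) ≠ +1` for every `i ≠ j`, then
`∏ i, (x² - a i) ≡ 0 (mod p^(2n))` has no integer solution. -/
theorem stmt_11 (n : ℕ) (hn : 1 ≤ n) (a : Fin n → ℤ) (hsf : ∀ i, Squarefree (a i))
    (j : Fin n) (p : ℕ) (hp : p.Prime) (hodd : p ≠ 2) (hdvd : (p : ℤ) ∣ a j)
    (h : ∀ i : Fin n, i ≠ j → @legendreSym p ⟨hp⟩ (a i) ≠ 1) :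
    ¬ ∃ x : ℤ, (p : ℤ) ^ (2 * n) ∣ ∏ i, (x ^ 2 - a i) := by
  rintro ⟨x, hx⟩
  have : Fact p.Prime := ⟨hp⟩
  have hpZ : Prime (p : ℤ) := Nat.prime_iff_prime_int.mp hp
  refine hpZ.not_pow_dvd_prod_of_not_sq_dvd Finset.univ _ (fun i _ => ?_) ?_ hx
  · by_cases hpa : (p : ℤ) ∣ a i
    · exact hpZ.not_sq_dvd_sq_sub_of_squarefree (hsf i) hpa x
    · have hij : i ≠ j := fun e => hpa (e ▸ hdvd)
      exact fun hd => legendreSym.not_dvd_sq_sub hpa (h i hij) x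
        ((dvd_pow_self _ two_ne_zero).trans hd)
  · rw [Finset.card_univ, Fintype.card_fin]
    omega
end

section
/- Let n ≥ 1 and let a₁, a₂, …, aₙ be square-free integers, none equal to 1, such that no aᵢ is of the form 8m + 1 for a nonzero integer m. Then the congruence (x² − a₁)(x² − a₂)⋯(x² − aₙ) ≡ 0 (mod 8ⁿ) has no integer solution. -/
/-- If `p` is prime and `p ^ (k + 1)` divides no `f i`, then `p ^ (k * #s + 1)` does not divide the
product of the `f i` over `s`. -/
theorem Prime.not_pow_dvd_prod {ι M : Type*} [CommMonoidWithZero M] [IsCancelMulZero M] {p : M}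
    (hp : Prime p) (s : Finset ι) (f : ι → M) (k : ℕ) (hf : ∀ i ∈ s, ¬ p ^ (k + 1) ∣ f i) :
    ¬ p ^ (s.card * k + 1) ∣ ∏ i ∈ s, f i := by
  rw [← emultiplicity_lt_iff_not_dvd, Finset.emultiplicity_prod hp]
  have hle : ∑ i ∈ s, emultiplicity p (f i) ≤ s.card • (k : ℕ∞) := by
    refine Finset.sum_le_card_nsmul _ _ _ fun i hi => ?_
    have := emultiplicity_lt_iff_not_dvd.mpr (hf i hi)
    exact Order.le_of_lt_add_one (by exact_mod_cast this)
  refine hle.trans_lt ?_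
  rw [nsmul_eq_mul]
  exact_mod_cast Nat.lt_succ_self _

/-- A square-free integer that is not `1` modulo `8` is not a square modulo `8`. -/
theorem Squarefree.not_eight_dvd_sq_sub {a : ℤ} (ha : Squarefree a) (h : a % 8 ≠ 1) (x : ℤ) :
    ¬ 8 ∣ x ^ 2 - a := by
  intro hdvd
  have h4 : ¬ (4 : ℤ) ∣ a := fun h4 => by
    have := Int.isUnit_iff.mp (ha 2 (by norm_num; exact h4))
    omega
  have hx : x ^ 2 % 8 = 0 ∨ x ^ 2 % 8 = 1 ∨ x ^ 2 % 8 = 4 := by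
    have : x % 8 = 0 ∨ x % 8 = 1 ∨ x % 8 = 2 ∨ x % 8 = 3 ∨ x % 8 = 4 ∨ x % 8 = 5 ∨ x % 8 = 6 ∨
        x % 8 = 7 := by omega
    rcases this with h | h | h | h | h | h | h | h <;> simp [pow_two, Int.mul_emod, h]
  omega


/-- Let `n ≥ 1` and `a 1, …, a n` be square-free integers, none equal to `1`, such
that no `a i` is of the form `8m + 1` for a nonzero integer `m`. Then
`∏ i, (x² - a i) ≡ 0 (mod 8^n)` has no integer solution. -/
theorem stmt_12 (n : ℕ) (hn : 1 ≤ n) (a : Fin n → ℤ) (hsf : ∀ i, Squarefree (a i))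
    (hne1 : ∀ i, a i ≠ 1)
    (h : ∀ i : Fin n, ¬ ∃ m : ℤ, m ≠ 0 ∧ a i = 8 * m + 1) :
    ¬ ∃ x : ℤ, (8 : ℤ) ^ n ∣ ∏ i, (x ^ 2 - a i) := by
  rintro ⟨x, hx⟩
  refine Int.prime_two.not_pow_dvd_prod Finset.univ (fun i => x ^ 2 - a i) 2 (fun i _ => ?_)
    (dvd_trans ?_ hx)
  · have h8 : a i % 8 ≠ 1 := fun h8 => h i
      ⟨a i / 8, fun h0 => hne1 i (by omega), by omega⟩
    simpa using (hsf i).not_eight_dvd_sq_sub h8 x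
  · rw [show (8 : ℤ) = 2 ^ 3 by norm_num, ← pow_mul, Finset.card_fin]
    exact pow_dvd_pow 2 (by omega)
end
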